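/- arXiv:2308.05885 — 2 statements merged into one kernel-verified Lean document; each statement's English description precedes it below -/
import Mathlib

section
/- Suppose θ(ζ₀) < ∞ and limsup_{ζ→∞} ( θ^α(ζ) · ∑_{s=ζ₀}^{ζ−1} q(s) ) > 1. Then every solution of equation (1.1) oscillates. -/
open Filter Finset

/-- The real `n`-th root, extended to negative reals as an odd function
(this is the genuine real `n`-th root when `n` is odd). -/
noncomputable def oddRoot (n : ℕ) (t : ℝ) : ℝ :=
  if t < 0 then -((-t) ^ ((n : ℝ))⁻¹) else t ^ ((n : ℝ))⁻¹

/-- `ratPow p n t` is the rational power `t ^ (p / n)`, defined for all real `t`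
when the denominator `n` is odd. -/
noncomputable def ratPow (p : ℤ) (n : ℕ) (t : ℝ) : ℝ := oddRoot n t ^ p

/-- Forward difference operator: `fwd x ζ = x (ζ+1) - x ζ`. -/
def fwd (x : ℤ → ℝ) (ζ : ℤ) : ℝ := x (ζ + 1) - x ζ

/-- `theta α r ζ = ∑_{s=ζ}^∞ (r s) ^ (-1/α)`. -/
noncomputable def theta (α : ℝ) (r : ℤ → ℝ) (ζ : ℤ) : ℝ :=
  ∑' k : ℕ, (r (ζ + k) ^ α⁻¹)⁻¹

/-- A real sequence is eventually positive. -/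
def EvPos (x : ℤ → ℝ) : Prop := ∃ N : ℤ, ∀ ζ ≥ N, 0 < x ζ

/-- A real sequence is eventually negative. -/
def EvNeg (x : ℤ → ℝ) : Prop := ∃ N : ℤ, ∀ ζ ≥ N, x ζ < 0

/-- A sequence oscillates if it is neither eventually positive nor eventually negative. -/
def Oscillates (x : ℤ → ℝ) : Prop := ¬ EvPos x ∧ ¬ EvNeg x

theorem ratPow_neg {m n : ℕ} (hm : Odd m) (hn0 : 0 < n) (t : ℝ) :
    ratPow m n (-t) = -ratPow m n t := by
  have hn : ((n : ℝ))⁻¹ ≠ 0 := by positivity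
  have hroot : oddRoot n (-t) = -oddRoot n t := by
    unfold oddRoot
    rcases lt_trichotomy t 0 with h | h | h
    · rw [if_neg (by linarith), if_pos h, neg_neg]
    · simp [h, Real.zero_rpow hn]
    · rw [if_pos (by linarith), if_neg (by linarith), neg_neg]
  simp only [ratPow, zpow_natCast, hroot, hm.neg_pow]

theorem ratPow_of_nonneg {m n : ℕ} {t : ℝ} (ht : 0 ≤ t) :
    ratPow m n t = t ^ ((m : ℝ) / n) := by
  simp only [ratPow, oddRoot, if_neg ht.not_gt, zpow_natCast]
  rw [← Real.rpow_natCast, ← Real.rpow_mul ht, inv_mul_eq_div]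

theorem ratPow_pos {m n : ℕ} {t : ℝ} (ht : 0 < t) : 0 < ratPow m n t := by
  rw [ratPow_of_nonneg ht.le]
  positivity

theorem ratPow_le_ratPow {m n : ℕ} {s t : ℝ} (hs : 0 ≤ s) (hst : s ≤ t) :
    ratPow m n s ≤ ratPow m n t := by
  rw [ratPow_of_nonneg hs, ratPow_of_nonneg (hs.trans hst)]
  exact Real.rpow_le_rpow hs hst (by positivity)

theorem pos_of_ratPow_pos {m n : ℕ} (hm : Odd m) (hn0 : 0 < n) {t : ℝ}
    (h : 0 < ratPow m n t) : 0 < t := by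
  by_contra! ht
  have h0 : 0 ≤ ratPow m n (-t) := by
    rw [ratPow_of_nonneg (by linarith)]
    exact Real.rpow_nonneg (by linarith) _
  rw [ratPow_neg hm hn0] at h0
  linarith

/-- A sequence on `ℤ` with nonincreasing steps from `N` on is nonincreasing there. -/
theorem le_of_succ_le {f : ℤ → ℝ} {N : ℤ} (h : ∀ ζ ≥ N, f (ζ + 1) ≤ f ζ)
    {a b : ℤ} (ha : N ≤ a) (hab : a ≤ b) : f b ≤ f a := by
  induction b, hab using Int.leInduction with
  | base => exact le_rfl
  | succ b hb ih => exact (h b (ha.trans hb)).trans ih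

theorem summable_shift {f : ℤ → ℝ} {a b : ℤ} (hab : a ≤ b)
    (h : Summable fun k : ℕ => f (a + k)) : Summable fun k : ℕ => f (b + k) := by
  obtain ⟨d, rfl⟩ := Int.le.dest hab
  refine ((summable_nat_add_iff d).2 h).congr fun k => ?_
  push_cast
  rw [add_assoc, add_comm (d : ℤ)]

theorem theta_nonneg {α : ℝ} {r : ℤ → ℝ} (hr : ∀ ζ, 0 < r ζ) (ζ : ℤ) : 0 ≤ theta α r ζ :=
  tsum_nonneg fun _ => inv_nonneg.2 (Real.rpow_nonneg (hr _).le _)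

theorem tendsto_theta {α : ℝ} {r : ℤ → ℝ} {ζ₀ : ℤ} :
    Tendsto (theta α r) atTop (nhds 0) := by
  have h := tendsto_sum_nat_add fun k : ℕ => (r (ζ₀ + k) ^ α⁻¹)⁻¹
  have hnat : Tendsto (fun ζ : ℤ => (ζ - ζ₀).toNat) atTop atTop :=
    tendsto_atTop.2 fun b => (eventually_ge_atTop (ζ₀ + b)).mono fun ζ hζ => by omega
  refine (h.comp hnat).congr' ((eventually_ge_atTop ζ₀).mono fun ζ hζ => ?_)
  refine tsum_congr fun k => ?_
  congr 3
  push_cast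
  rw [Int.toNat_of_nonneg (by omega)]
  ring

theorem sum_Icc_sub_one_succ (q : ℤ → ℝ) {a ζ : ℤ} (h : a ≤ ζ) :
    ∑ s ∈ Icc a (ζ + 1 - 1), q s = ∑ s ∈ Icc a (ζ - 1), q s + q ζ := by
  have : Icc a (ζ + 1 - 1) = insert ζ (Icc a (ζ - 1)) := by
    ext s
    simp only [mem_Icc, mem_insert]
    omega
  rw [this, sum_insert (by simp), add_comm]

/-- If `r (Δx)^α` stays below `-w < 0` along a positive sequence `x`, then `x` dominates
the corresponding tail of `θ`. -/
theorem mul_theta_rpow_le {m n : ℕ} {α : ℝ} (hm : Odd m) (hn0 : 0 < n) (hα : α = (m : ℝ) / n)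
    (hα0 : 0 < α) {r x : ℤ → ℝ} (hr : ∀ ζ, 0 < r ζ) {ζ : ℤ} {w : ℝ} (hw : 0 < w)
    (hx : ∀ s ≥ ζ, 0 < x s) (hy : ∀ s ≥ ζ, r s * ratPow m n (fwd x s) ≤ -w)
    (hs : Summable fun k : ℕ => (r (ζ + k) ^ α⁻¹)⁻¹) :
    w * theta α r ζ ^ α ≤ ratPow m n (x ζ) := by
  have hstep : ∀ s ≥ ζ, x (s + 1) + w ^ α⁻¹ * (r s ^ α⁻¹)⁻¹ ≤ x s := by
    intro s hsζ
    have hδ : w / r s ≤ ratPow m n (-fwd x s) := by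
      rw [ratPow_neg hm hn0, div_le_iff₀ (hr s)]
      linarith [hy s hsζ]
    have hδ0 : 0 < -fwd x s :=
      pos_of_ratPow_pos hm hn0 ((div_pos hw (hr s)).trans_le hδ)
    rw [ratPow_of_nonneg hδ0.le, ← hα] at hδ
    have h := Real.rpow_le_rpow (div_pos hw (hr s)).le hδ (inv_nonneg.2 hα0.le)
    rw [Real.rpow_rpow_inv hδ0.le hα0.ne', Real.div_rpow hw.le (hr s).le, div_eq_mul_inv] at h
    unfold fwd at h
    linarith
  have hsum : ∀ j : ℕ,
      x (ζ + j) + w ^ α⁻¹ * ∑ k ∈ range j, (r (ζ + k) ^ α⁻¹)⁻¹ ≤ x ζ := by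
    intro j
    induction j with
    | zero => simp
    | succ j ih =>
      have h := hstep (ζ + j) (by omega)
      rw [sum_range_succ, mul_add]
      push_cast
      rw [← add_assoc ζ]
      linarith
  have hle : w ^ α⁻¹ * theta α r ζ ≤ x ζ := by
    refine le_of_tendsto' (hs.hasSum.tendsto_sum_nat.const_mul _) fun j => ?_
    linarith [hsum j, hx (ζ + j) (by omega)]
  have hθ0 := theta_nonneg (α := α) hr ζ
  have h := Real.rpow_le_rpow (mul_nonneg (Real.rpow_nonneg hw.le _) hθ0) hle hα0.le
  rwa [Real.mul_rpow (Real.rpow_nonneg hw.le _) hθ0, Real.rpow_inv_rpow hw.le hα0.ne', hα,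
    ← ratPow_of_nonneg (hx ζ le_rfl).le, ← hα] at h

/-- Along an eventually positive solution, `θ^α ∑ q` exceeds `1` at most by a multiple
of `θ^α`. -/
theorem exists_theta_mul_sum_le {m n : ℕ} {α : ℝ} (hm : Odd m) (hn0 : 0 < n)
    (hα : α = (m : ℝ) / n) (hα0 : 0 < α) {ζ₀ σ : ℤ} (hσ : 0 ≤ σ)
    {r q : ℤ → ℝ} (hr : ∀ ζ, 0 < r ζ) (hq : ∀ ζ, 0 ≤ q ζ)
    (hq0 : ∀ N : ℤ, ∃ ζ ≥ N, q ζ ≠ 0)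
    (hθ : Summable (fun k : ℕ => (r (ζ₀ + k) ^ α⁻¹)⁻¹)) {x : ℤ → ℝ}
    (hsol : ∀ ζ ≥ ζ₀, fwd (fun t => r t * ratPow m n (fwd x t)) ζ
        + q ζ * ratPow m n (x (ζ - σ)) = 0) (hx : EvPos x) :
    ∃ C : ℝ, ∀ᶠ ζ in atTop,
      theta α r ζ ^ α * ∑ s ∈ Icc ζ₀ (ζ - 1), q s ≤ 1 + theta α r ζ ^ α * C := by
  obtain ⟨N₀, hN₀⟩ := hx
  set S : ℤ → ℝ := fun ζ => ∑ s ∈ Icc ζ₀ (ζ - 1), q s with hS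
  set y : ℤ → ℝ := fun t => r t * ratPow m n (fwd x t) with hy
  have hSstep : ∀ ζ ≥ ζ₀, S (ζ + 1) = S ζ + q ζ := fun ζ h => sum_Icc_sub_one_succ q h
  have hystep : ∀ ζ ≥ ζ₀, y (ζ + 1) = y ζ - q ζ * ratPow m n (x (ζ - σ)) := by
    intro ζ h
    have h1 : y (ζ + 1) - y ζ + q ζ * ratPow m n (x (ζ - σ)) = 0 := hsol ζ h
    linarith
  have hθα : ∀ ζ, 0 ≤ theta α r ζ ^ α := fun ζ => Real.rpow_nonneg (theta_nonneg hr ζ) _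
  obtain ⟨N, hNζ, hN⟩ : ∃ N, ζ₀ ≤ N ∧ N₀ + σ ≤ N := ⟨_, le_max_left _ _, le_max_right _ _⟩
  have hpos : ∀ ζ ≥ N, 0 < ratPow m n (x (ζ - σ)) :=
    fun ζ h => ratPow_pos (hN₀ _ (by omega))
  have hanti : ∀ ζ ≥ N, y (ζ + 1) ≤ y ζ := by
    intro ζ h
    rw [hystep ζ (by omega)]
    linarith [mul_nonneg (hq ζ) (hpos ζ h).le]
  by_cases hsign : ∀ ζ ≥ N, 0 < y ζ
  · have hinc : ∀ ζ ≥ N, -x (ζ + 1) ≤ -x ζ := by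
      intro ζ h
      have := pos_of_ratPow_pos hm hn0 (pos_of_mul_pos_right (hsign ζ h) (hr ζ).le)
      unfold fwd at this
      linarith
    have hxN : 0 < x N := hN₀ N (by omega)
    set c := ratPow m n (x N) with hc
    have hc0 : 0 < c := ratPow_pos hxN
    have hdec : ∀ ζ ≥ N + σ, y (ζ + 1) + c * S (ζ + 1) ≤ y ζ + c * S ζ := by
      intro ζ h
      have h1 : x N ≤ x (ζ - σ) :=
        neg_le_neg_iff.1 (le_of_succ_le (f := fun ζ => -x ζ) hinc le_rfl (by omega))
      have h2 := mul_le_mul_of_nonneg_left (ratPow_le_ratPow (m := m) (n := n) hxN.le h1) (hq ζ)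
      rw [hystep ζ (by omega), hSstep ζ (by omega)]
      linarith
    refine ⟨(y (N + σ) + c * S (N + σ)) / c,
      (eventually_ge_atTop (N + σ)).mono fun ζ hζ => ?_⟩
    have h := le_of_succ_le (f := fun ζ => y ζ + c * S ζ) hdec le_rfl hζ
    have hSC : S ζ ≤ (y (N + σ) + c * S (N + σ)) / c := by
      rw [le_div_iff₀ hc0]
      linarith [hsign ζ (by omega)]
    linarith [mul_le_mul_of_nonneg_left hSC (hθα ζ)]
  · push Not at hsign
    obtain ⟨M, hM, hyM⟩ := hsign
    obtain ⟨K, hK, hqK⟩ := hq0 M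
    have hyK : y (K + 1) < 0 := by
      rw [hystep K (by omega)]
      linarith [mul_pos ((hq K).lt_of_ne' hqK) (hpos K (by omega)), le_of_succ_le hanti hM hK]
    have hyneg : ∀ ζ ≥ K + 1, y ζ < 0 :=
      fun ζ h => (le_of_succ_le hanti (by omega) h).trans_lt hyK
    have hdecr : ∀ ζ ≥ K + 1, x (ζ + 1) ≤ x ζ := by
      intro ζ h
      have h1 : 0 < r ζ * ratPow m n (-fwd x ζ) := by
        rw [ratPow_neg hm hn0]
        linarith [hyneg ζ h]
      have := pos_of_ratPow_pos hm hn0 (pos_of_mul_pos_right h1 (hr ζ).le)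
      unfold fwd at this
      linarith
    set L := K + 1 + σ with hL
    have hSmono : ∀ ζ ≥ L, S L ≤ S ζ := fun ζ h =>
      neg_le_neg_iff.1 <| le_of_succ_le (f := fun ζ => -S ζ) (N := L)
        (fun s hs => by linarith [hSstep s (by omega), hq s]) le_rfl h
    have hbound : ∀ ζ ≥ L, ratPow m n (x ζ) * (S ζ - S L) ≤ -y ζ := by
      intro ζ h
      induction ζ, h using Int.leInduction with
      | base => simpa using (hyneg L (by omega)).le
      | succ ζ h ih =>
        have hx1 : 0 ≤ x (ζ + 1) := (hN₀ _ (by omega)).le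
        have h1 : ratPow m n (x (ζ + 1)) ≤ ratPow m n (x ζ) :=
          ratPow_le_ratPow hx1 (hdecr ζ (by omega))
        have h2 : ratPow m n (x (ζ + 1)) ≤ ratPow m n (x (ζ - σ)) :=
          ratPow_le_ratPow hx1 (le_of_succ_le hdecr (by omega) (by omega))
        rw [hystep ζ (by omega), hSstep ζ (by omega)]
        linarith [mul_le_mul_of_nonneg_right h1 (sub_nonneg.2 (hSmono ζ h)),
          mul_le_mul_of_nonneg_left h2 (hq ζ)]
    refine ⟨S L, (eventually_ge_atTop L).mono fun ζ hζ => ?_⟩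
    have hp : 0 < ratPow m n (x ζ) := ratPow_pos (hN₀ ζ (by omega))
    have h1 : -y ζ * theta α r ζ ^ α ≤ ratPow m n (x ζ) := by
      refine mul_theta_rpow_le hm hn0 hα hα0 hr (neg_pos.2 (hyneg ζ (by omega)))
        (fun s hs => hN₀ s (by omega)) (fun s hs => ?_)
        (summable_shift (f := fun ζ => (r ζ ^ α⁻¹)⁻¹) (by omega) hθ)
      rw [neg_neg]
      exact le_of_succ_le hanti (by omega) hs
    have h2 := mul_le_mul_of_nonneg_right (hbound ζ hζ) (hθα ζ)
    have h3 : theta α r ζ ^ α * (S ζ - S L) ≤ 1 := by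
      refine le_of_mul_le_mul_left ?_ hp
      linarith
    linarith

theorem not_evPos_of_limsup {m n : ℕ} {α : ℝ} (hm : Odd m) (hn0 : 0 < n)
    (hα : α = (m : ℝ) / n) (hα0 : 0 < α) {ζ₀ σ : ℤ} (hσ : 0 ≤ σ)
    {r q : ℤ → ℝ} (hr : ∀ ζ, 0 < r ζ) (hq : ∀ ζ, 0 ≤ q ζ)
    (hq0 : ∀ N : ℤ, ∃ ζ ≥ N, q ζ ≠ 0)
    (hθ : Summable (fun k : ℕ => (r (ζ₀ + k) ^ α⁻¹)⁻¹))
    (hls : 1 < Filter.limsup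
      (fun ζ : ℤ => theta α r ζ ^ α * ∑ s ∈ Finset.Icc ζ₀ (ζ - 1), q s) atTop)
    {x : ℤ → ℝ} (hsol : ∀ ζ ≥ ζ₀, fwd (fun t => r t * ratPow m n (fwd x t)) ζ
        + q ζ * ratPow m n (x (ζ - σ)) = 0) : ¬ EvPos x := by
  intro hx
  obtain ⟨C, hC⟩ := exists_theta_mul_sum_le hm hn0 hα hα0 hσ hr hq hq0 hθ hsol hx
  have hlim : Tendsto (fun ζ : ℤ => 1 + theta α r ζ ^ α * C) atTop (nhds 1) := by
    have h := (tendsto_theta (α := α) (r := r) (ζ₀ := ζ₀)).rpow_const (p := α) (Or.inr hα0.le)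
    simpa [Real.zero_rpow hα0.ne'] using (h.mul_const C).const_add 1
  have hle := limsup_le_limsup hC
    (IsBoundedUnder.isCoboundedUnder_le <| isBoundedUnder_of ⟨0, fun ζ =>
      mul_nonneg (Real.rpow_nonneg (theta_nonneg hr ζ) _) (sum_nonneg fun s _ => hq s)⟩)
    hlim.isBoundedUnder_le
  rw [hlim.limsup_eq] at hle
  linarith

/-- Theorem 2.3. Under the noncanonical condition `θ(ζ₀) < ∞`, if
`limsup_{ζ→∞} (θ^α(ζ) · ∑_{s=ζ₀}^{ζ-1} q s) > 1`, then every solution of (1.1)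
oscillates. -/
theorem statement2
    (m n : ℕ) (α : ℝ) (hm : Odd m) (hn : Odd n) (hmn : Nat.Coprime m n)
    (hm0 : 0 < m) (hn0 : 0 < n) (hα : α = (m : ℝ) / n)
    (ζ₀ σ : ℤ) (hσ : 0 ≤ σ)
    (r q : ℤ → ℝ) (hr : ∀ ζ, 0 < r ζ) (hq : ∀ ζ, 0 ≤ q ζ)
    (hq0 : ∀ N : ℤ, ∃ ζ ≥ N, q ζ ≠ 0)
    (hθ : Summable (fun k : ℕ => (r (ζ₀ + k) ^ α⁻¹)⁻¹))
    (hls : 1 < Filter.limsup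
      (fun ζ : ℤ => theta α r ζ ^ α * ∑ s ∈ Finset.Icc ζ₀ (ζ - 1), q s) atTop)
    (x : ℤ → ℝ) (hnt : ∃ ζ, x ζ ≠ 0)
    (hsol : ∀ ζ ≥ ζ₀, fwd (fun t => r t * ratPow m n (fwd x t)) ζ
        + q ζ * ratPow m n (x (ζ - σ)) = 0) :
    Oscillates x := by
  have hα0 : 0 < α := by
    rw [hα]
    positivity
  refine ⟨not_evPos_of_limsup hm hn0 hα hα0 hσ hr hq hq0 hθ hls hsol, ?_⟩
  rintro ⟨N, hN⟩
  refine not_evPos_of_limsup hm hn0 hα hα0 hσ hr hq hq0 hθ hls (x := fun ζ => -x ζ)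
    (fun ζ hζ => ?_) ⟨N, fun ζ hζ => neg_pos.2 (hN ζ hζ)⟩
  have hfwd : ∀ t, fwd (fun ζ => -x ζ) t = -fwd x t := fun t => by
    unfold fwd
    ring
  have h := hsol ζ hζ
  simp only [hfwd, ratPow_neg hm hn0]
  unfold fwd at h ⊢
  linarith
end

section
/- Suppose θ(ζ₀) < ∞. If {x(ζ)} is an eventually positive solution of equation (1.1) with Δx(ζ) < 0 eventually, then for all sufficiently large ζ one has x(ζ−σ) ≥ x(ζ) ≥ −θ(ζ)·r^{1/α}(ζ)·Δx(ζ) ≥ 0. -/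
open Filter Finset

theorem ratPow_of_neg {m n : ℕ} (hm : Odd m) {t : ℝ} (ht : t < 0) :
    ratPow m n t = -((-t) ^ ((m : ℝ) / n)) := by
  rw [ratPow, oddRoot, if_pos ht, zpow_natCast, hm.neg_pow, ← Real.rpow_mul_natCast (by linarith),
    div_eq_inv_mul]

theorem ratPow_nonneg (p : ℤ) (n : ℕ) {t : ℝ} (ht : 0 ≤ t) : 0 ≤ ratPow p n t := by
  rw [ratPow, oddRoot, if_neg ht.not_gt]
  positivity

theorem rpow_inv_mul_le_of_mul_rpow_le {α a b u v : ℝ} (hα : 0 < α) (ha : 0 ≤ a) (hb : 0 ≤ b)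
    (hu : 0 ≤ u) (hv : 0 ≤ v) (h : a * u ^ α ≤ b * v ^ α) :
    a ^ α⁻¹ * u ≤ b ^ α⁻¹ * v := by
  have key := Real.rpow_le_rpow (by positivity) h (inv_nonneg.mpr hα.le)
  rwa [Real.mul_rpow ha (by positivity), Real.mul_rpow hb (by positivity),
    Real.rpow_rpow_inv hu hα.ne', Real.rpow_rpow_inv hv hα.ne'] at key

theorem antitone_from_of_fwd_nonpos {f : ℤ → ℝ} {N : ℤ} (hf : ∀ ζ ≥ N, fwd f ζ ≤ 0)
    {a b : ℤ} (ha : N ≤ a) (hab : a ≤ b) : f b ≤ f a := by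
  induction b, hab using Int.leInduction with
  | base => exact le_rfl
  | succ b hb ih =>
    have := hf b (ha.trans hb)
    rw [fwd] at this
    linarith

/-- Suppose `θ(ζ₀) < ∞`. If `x` is an eventually positive solution of
(1.1) with `Δx(ζ) < 0` eventually, then eventually
`x(ζ-σ) ≥ x(ζ) ≥ -θ(ζ)·r^{1/α}(ζ)·Δx(ζ) ≥ 0`. -/
theorem statement9
    (m n : ℕ) (α : ℝ) (hm : Odd m) (hn : Odd n) (hmn : Nat.Coprime m n)
    (hm0 : 0 < m) (hn0 : 0 < n) (hα : α = (m : ℝ) / n)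
    (ζ₀ σ : ℤ) (hσ : 0 ≤ σ)
    (r q : ℤ → ℝ) (hr : ∀ ζ, 0 < r ζ) (hq : ∀ ζ, 0 ≤ q ζ)
    (hq0 : ∀ N : ℤ, ∃ ζ ≥ N, q ζ ≠ 0)
    (hθ : Summable (fun k : ℕ => (r (ζ₀ + k) ^ α⁻¹)⁻¹))
    (x : ℤ → ℝ)
    (hsol : ∀ ζ ≥ ζ₀, fwd (fun t => r t * ratPow m n (fwd x t)) ζ
        + q ζ * ratPow m n (x (ζ - σ)) = 0)
    (hpos : EvPos x)
    (hdec : ∃ N : ℤ, ∀ ζ ≥ N, fwd x ζ < 0) :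
    ∃ N : ℤ, ∀ ζ ≥ N,
      x (ζ - σ) ≥ x ζ ∧
      x ζ ≥ -(theta α r ζ * r ζ ^ α⁻¹ * fwd x ζ) ∧
      -(theta α r ζ * r ζ ^ α⁻¹ * fwd x ζ) ≥ 0 := by
  have hα0 : 0 < α := by rw [hα]; positivity
  obtain ⟨P, hP⟩ := hpos
  obtain ⟨D, hD⟩ := hdec
  obtain ⟨N, hNζ, hNP, hND⟩ : ∃ N : ℤ, ζ₀ ≤ N ∧ P + σ ≤ N ∧ D + σ ≤ N :=
    ⟨max ζ₀ (max (P + σ) (D + σ)), by simp, by simp, by simp⟩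
  have hflux : ∀ s ≥ N, fwd (fun t => r t * ratPow m n (fwd x t)) s ≤ 0 := fun s hs => by
    have h := hsol s (hNζ.trans hs)
    have h' := mul_nonneg (hq s) (ratPow_nonneg m n (hP (s - σ) (by omega)).le)
    linarith
  refine ⟨N, fun ζ hζ => ?_⟩
  have hneg : ∀ k : ℕ, fwd x (ζ + k) < 0 := fun k => hD _ (by omega)
  have hneg0 : fwd x ζ < 0 := hD _ (by omega)
  set w := r ζ ^ α⁻¹ * -fwd x ζ with hw
  have hwpos : 0 < w := mul_pos (Real.rpow_pos_of_pos (hr ζ) _) (neg_pos.mpr hneg0)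
  have hterm : ∀ k : ℕ, 0 < r (ζ + k) ^ α⁻¹ := fun k => Real.rpow_pos_of_pos (hr _) _
  have hstep : ∀ k : ℕ, (r (ζ + k) ^ α⁻¹)⁻¹ * w ≤ x (ζ + k) - x (ζ + (k + 1 : ℕ)) := fun k => by
    have h := antitone_from_of_fwd_nonpos hflux hζ (show ζ ≤ ζ + k by omega)
    simp only [ratPow_of_neg hm (hneg k), ratPow_of_neg hm hneg0, ← hα] at h
    have h' := rpow_inv_mul_le_of_mul_rpow_le hα0 (hr ζ).le (hr (ζ + k)).le
      (neg_pos.mpr hneg0).le (neg_pos.mpr (hneg k)).le (by linarith)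
    rw [inv_mul_le_iff₀ (hterm k)]
    refine h'.trans_eq ?_
    rw [fwd, neg_sub, Nat.cast_succ, add_assoc]
  have hpartial : ∀ K : ℕ, ∑ k ∈ range K, (r (ζ + k) ^ α⁻¹)⁻¹ ≤ x ζ / w := fun K => by
    rw [le_div_iff₀ hwpos, sum_mul]
    calc _ ≤ ∑ k ∈ range K, (x (ζ + k) - x (ζ + (k + 1 : ℕ))) := sum_le_sum fun k _ => hstep k
      _ = x ζ - x (ζ + K) := by
        simpa using sum_range_sub' (fun k : ℕ => x (ζ + k)) K
      _ ≤ x ζ := by linarith [hP (ζ + K) (by omega)]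
  have hθle : theta α r ζ ≤ x ζ / w :=
    Real.tsum_le_of_sum_range_le (fun k => (inv_pos.mpr (hterm k)).le) hpartial
  have hθ0 : 0 ≤ theta α r ζ := tsum_nonneg fun k => (inv_pos.mpr (hterm k)).le
  have hrw : -(theta α r ζ * r ζ ^ α⁻¹ * fwd x ζ) = theta α r ζ * w := by rw [hw]; ring
  rw [hrw]
  exact ⟨antitone_from_of_fwd_nonpos (fun s hs => (hD s hs).le) (by omega) (by omega),
    (le_div_iff₀ hwpos).mp hθle, mul_nonneg hθ0 hwpos.le⟩
end
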